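/- arXiv:2111.03417 — 3 statements merged into one kernel-verified Lean document; each statement's English description precedes it below -/
import Mathlib

section
/- Let R be a commutative ring and M an R-module. Then M is τ_q-finitely presented if and only if M ⊗_R T(R[x]) is a finitely presented T(R[x])-module. -/
open Polynomial TensorProduct

universe u v

/-- An ideal is *semi-regular* if it contains a finitely generated dense subideal
(an ideal is *dense* if its annihilator is zero). -/
def Ideal.IsSemiregular {R : Type*} [CommRing R] (I : Ideal R) : Prop :=
  ∃ J : Ideal R, J ≤ I ∧ J.FG ∧ Submodule.annihilator J = ⊥

/-- A module is *Q-torsion* if every element is annihilated by some finitely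
generated semi-regular ideal. -/
def IsQTorsion (R : Type*) (M : Type*) [CommRing R] [AddCommGroup M] [Module R M] : Prop :=
  ∀ m : M, ∃ I : Ideal R, I.FG ∧ I.IsSemiregular ∧ ∀ a ∈ I, a • m = 0

/-- A module is *τ_q-finitely presented* if it receives a linear map from a finitely
presented module with Q-torsion kernel and cokernel. -/
def IsTauQFP (R : Type u) (M : Type v) [CommRing R] [AddCommGroup M] [Module R M] : Prop :=
  ∃ (N : Type v) (_ : AddCommGroup N) (_ : Module R N) (f : N →ₗ[R] M),
    Module.FinitePresentation R N ∧ IsQTorsion R (LinearMap.ker f) ∧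
      IsQTorsion R (M ⧸ LinearMap.range f)

/-- An element `m` satisfies `1 ⊗ m = 0` in `T(R[x]) ⊗ M` if and only if it is annihilated by a
finitely generated semi-regular ideal. -/
lemma one_tmul_eq_zero_iff_exists_semiregular {R : Type*} [CommRing R] {M : Type*}
    [AddCommGroup M] [Module R M] (m : M) :
    (1 : FractionRing R[X]) ⊗ₜ[R] m = 0 ↔
      ∃ I : Ideal R, I.FG ∧ I.IsSemiregular ∧ ∀ a ∈ I, a • m = 0 := by
  constructor
  · intro h
    have h' : (1 : FractionRing R[X]) ⊗ₜ[R[X]] ((1 : R[X]) ⊗ₜ[R] m) = 0 := by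
      apply (AlgebraTensorModule.cancelBaseChange R R[X] (FractionRing R[X])
        (FractionRing R[X]) M).injective
      simpa using h
    obtain ⟨⟨f, hf⟩, hfm⟩ := (IsLocalizedModule.eq_zero_iff (nonZeroDivisors R[X])
      (TensorProduct.mk R[X] (FractionRing R[X]) (R[X] ⊗[R] M) 1)).1 h'
    have hfm' : f ⊗ₜ[R] m = 0 := by
      simpa [Submonoid.smul_def, TensorProduct.smul_tmul'] using hfm
    have hcoeff (i : ℕ) : f.coeff i • m = 0 := by
      simpa using congrArg (TensorProduct.lid R M ∘ (lcoeff R i).rTensor M) hfm'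
    have hfg : (Ideal.span (Set.range f.coeff)).FG :=
      Submodule.fg_span (Polynomial.finite_range_coeff f)
    refine ⟨Ideal.span (Set.range f.coeff), hfg, ⟨_, le_rfl, hfg, ?_⟩, fun a ha ↦ ?_⟩
    · refine (Submodule.eq_bot_iff _).2 fun a ha ↦ ?_
      by_contra ha0
      refine Polynomial.notMem_nonZeroDivisors_iff.2 ⟨a, ha0, ?_⟩ hf
      ext i
      simpa using Submodule.mem_annihilator.1 ha _ (Ideal.subset_span ⟨i, rfl⟩)
    · have hle : Ideal.span (Set.range f.coeff) ≤ LinearMap.ker (LinearMap.toSpanSingleton R M m) :=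
        Ideal.span_le.2 (by rintro _ ⟨i, rfl⟩; simpa using hcoeff i)
      simpa using hle ha
  · rintro ⟨I, -, ⟨J, hJI, hJ, hJ0⟩, hI⟩
    obtain ⟨n, s, rfl⟩ := Submodule.fg_iff_exists_fin_generating_family.1 hJ
    let f : R[X] := ∑ i : Fin n, monomial (i : ℕ) (s i)
    have hf : f ∈ nonZeroDivisors R[X] := by
      by_contra hf
      obtain ⟨a, ha, haf⟩ := Polynomial.notMem_nonZeroDivisors_iff.1 hf
      refine ha ((Submodule.mem_bot R).1 (hJ0 ▸ ?_))
      rw [Submodule.mem_annihilator_span]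
      rintro ⟨_, i, rfl⟩
      have := congrArg (fun p ↦ p.coeff (i : ℕ)) haf
      simpa [f, coeff_monomial, Fin.val_inj] using this
    have hfm : f ⊗ₜ[R] m = 0 := by
      simp only [f, TensorProduct.sum_tmul]
      refine Finset.sum_eq_zero fun i _ ↦ ?_
      rw [← mul_one (s i), ← smul_eq_mul, ← smul_monomial, TensorProduct.smul_tmul,
        hI _ (hJI (Submodule.subset_span ⟨i, rfl⟩)), TensorProduct.tmul_zero]
    have hfm' : algebraMap R[X] (FractionRing R[X]) f ⊗ₜ[R] m = 0 := by
      simpa using congrArg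
        ((IsScalarTower.toAlgHom R R[X] (FractionRing R[X])).toLinearMap.rTensor M) hfm
    have hu := IsLocalization.map_units (FractionRing R[X]) ⟨f, hf⟩
    rw [← hu.smul_eq_zero, TensorProduct.smul_tmul', smul_eq_mul, mul_one]
    exact hfm'

lemma isQTorsion_iff_subsingleton {R : Type*} [CommRing R] {M : Type*}
    [AddCommGroup M] [Module R M] :
    IsQTorsion R M ↔ Subsingleton (FractionRing R[X] ⊗[R] M) := by
  simp only [IsQTorsion, ← one_tmul_eq_zero_iff_exists_semiregular]
  refine ⟨fun h ↦ subsingleton_of_forall_eq 0 fun x ↦ ?_, fun h m ↦ Subsingleton.elim _ _⟩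
  induction x with
  | zero => rfl
  | add x y hx hy => rw [hx, hy, add_zero]
  | tmul t m => rw [← mul_one t, ← smul_eq_mul, ← TensorProduct.smul_tmul', h, smul_zero]

instance Module.Flat.fractionRing_polynomial {R : Type*} [CommRing R] :
    Module.Flat R (FractionRing R[X]) :=
  have := IsLocalization.flat (FractionRing R[X]) (nonZeroDivisors R[X])
  Module.Flat.trans R R[X] (FractionRing R[X])

section

variable {R : Type*} [CommRing R] {M N : Type*} [AddCommGroup M] [AddCommGroup N]
  [Module R M] [Module R N]

lemma Module.Flat.subsingleton_tensor_ker_iff (A : Type*) [AddCommGroup A] [Module R A]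
    [Module.Flat R A] (f : N →ₗ[R] M) :
    Subsingleton (A ⊗[R] LinearMap.ker f) ↔ Function.Injective (f.lTensor A) := by
  have hex : Function.Exact ((LinearMap.ker f).subtype.lTensor A) (f.lTensor A) :=
    Module.Flat.lTensor_exact A (LinearMap.exact_subtype_ker_map f)
  have hinj := Module.Flat.lTensor_preserves_injective_linearMap (M := A)
    (LinearMap.ker f).subtype (LinearMap.ker f).injective_subtype
  rw [← LinearMap.ker_eq_bot, LinearMap.exact_iff.1 hex, LinearMap.range_eq_bot]
  refine ⟨fun h ↦ Subsingleton.elim _ _, fun h ↦ ⟨fun x y ↦ hinj (by rw [h]; rfl)⟩⟩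

lemma TensorProduct.subsingleton_quotient_range_iff (A : Type*) [AddCommGroup A] [Module R A]
    (f : N →ₗ[R] M) :
    Subsingleton (A ⊗[R] (M ⧸ LinearMap.range f)) ↔ Function.Surjective (f.lTensor A) := by
  have hex : Function.Exact (f.lTensor A) ((LinearMap.range f).mkQ.lTensor A) :=
    lTensor_exact A (LinearMap.exact_map_mkQ_range f) (Submodule.mkQ_surjective _)
  have hsurj := LinearMap.lTensor_surjective A (Submodule.mkQ_surjective (LinearMap.range f))
  rw [← LinearMap.range_eq_top, ← LinearMap.exact_iff.1 hex, LinearMap.ker_eq_top]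
  refine ⟨fun h ↦ LinearMap.ext fun x ↦ Subsingleton.elim _ _, fun h ↦ ⟨fun x y ↦ ?_⟩⟩
  obtain ⟨x, rfl⟩ := hsurj x
  obtain ⟨y, rfl⟩ := hsurj y
  rw [h]; rfl

variable (R M) in
/-- If the base change of a module is finite, it is generated by the image of a finitely generated
submodule. -/
lemma Submodule.exists_fg_baseChange_eq_top (A : Type*) [CommRing A] [Algebra R A]
    [Module.Finite A (A ⊗[R] M)] : ∃ P : Submodule R M, P.FG ∧ P.baseChange A = ⊤ := by
  classical
  have htop : span A (Set.range (TensorProduct.mk R A M 1)) = ⊤ := by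
    rw [← baseChange_top, baseChange_eq_span, Submodule.map_top, LinearMap.coe_range]
  obtain ⟨t, ht, hspan⟩ := (fg_span_iff_fg_span_finset_subset _).1 (htop ▸ Module.Finite.fg_top)
  rw [← Set.image_univ] at ht
  obtain ⟨s, -, rfl⟩ := Finset.subset_set_image_iff.1 ht
  exact ⟨span R s, ⟨s, rfl⟩, by rw [baseChange_span, ← Finset.coe_image, ← hspan, htop]⟩

lemma LinearMap.range_baseChange (A : Type*) [CommRing A] [Algebra R A] (f : N →ₗ[R] M) :
    LinearMap.range (f.baseChange A) = (LinearMap.range f).baseChange A := by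
  conv_lhs => rw [← f.subtype_comp_codRestrict _ f.mem_range_self, LinearMap.baseChange_comp]
  refine LinearMap.range_comp_of_range_eq_top _ (LinearMap.range_eq_top.2 ?_)
  exact LinearMap.lTensor_surjective A f.surjective_rangeRestrict

/-- A linear map has Q-torsion kernel and cokernel if and only if its base change to `T(R[x])` is
bijective. -/
lemma isQTorsion_ker_and_coker_iff (f : N →ₗ[R] M) :
    IsQTorsion R (LinearMap.ker f) ∧ IsQTorsion R (M ⧸ LinearMap.range f) ↔
      Function.Bijective (f.baseChange (FractionRing R[X])) := by
  rw [isQTorsion_iff_subsingleton, isQTorsion_iff_subsingleton,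
    Module.Flat.subsingleton_tensor_ker_iff, TensorProduct.subsingleton_quotient_range_iff]
  rfl

end

/-- An `R`-module `M` is τ_q-finitely presented if and only if `M ⊗_R T(R[x])` is a
finitely presented `T(R[x])`-module. -/
theorem statement4 (R : Type u) [CommRing R] (M : Type u) [AddCommGroup M] [Module R M] :
    IsTauQFP R M ↔
      Module.FinitePresentation (FractionRing (Polynomial R))
        ((FractionRing (Polynomial R)) ⊗[R] M) := by
  constructor
  · rintro ⟨N, _, _, f, hN, hf⟩
    exact .of_equiv (LinearEquiv.ofBijective _ ((isQTorsion_ker_and_coker_iff f).1 hf))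
  · intro h
    obtain ⟨P, hP, hPtop⟩ := Submodule.exists_fg_baseChange_eq_top R M (FractionRing R[X])
    obtain ⟨n, g, hg⟩ := P.fg_iff_exists_fin_linearMap.1 hP
    have hgsurj : Function.Surjective (g.baseChange (FractionRing R[X])) := by
      rw [← LinearMap.range_eq_top, LinearMap.range_baseChange, hg, hPtop]
    have hker := Module.FinitePresentation.fg_ker _ hgsurj
    have hex : Function.Exact ((LinearMap.ker g).subtype.baseChange (FractionRing R[X]))
        (g.baseChange (FractionRing R[X])) :=
      Module.Flat.lTensor_exact _ (LinearMap.exact_subtype_ker_map g)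
    have hinj : Function.Injective
        ((LinearMap.ker g).subtype.baseChange (FractionRing R[X])) :=
      Module.Flat.lTensor_preserves_injective_linearMap _ (LinearMap.ker g).injective_subtype
    have : Module.Finite (FractionRing R[X]) (FractionRing R[X] ⊗[R] LinearMap.ker g) := by
      rw [LinearMap.exact_iff.1 hex, ← Module.Finite.iff_fg] at hker
      exact .equiv (LinearEquiv.ofInjective _ hinj).symm
    obtain ⟨K, hK, hKtop⟩ :=
      Submodule.exists_fg_baseChange_eq_top R (LinearMap.ker g) (FractionRing R[X])
    let K' := K.map (LinearMap.ker g).subtype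
    have hK' : K'.FG := hK.map _
    let f := K'.liftQ g (Submodule.map_subtype_le _ _)
    have hf (y) : f.baseChange (FractionRing R[X]) (K'.mkQ.baseChange _ y) =
        g.baseChange _ y := by
      rw [← LinearMap.comp_apply, ← LinearMap.baseChange_comp, K'.liftQ_mkQ]
    refine ⟨_, _, _, f, Module.finitePresentation_of_surjective _ K'.mkQ_surjective
      (by rwa [K'.ker_mkQ]), ?_⟩
    refine (isQTorsion_ker_and_coker_iff f).2 ⟨?_, fun x ↦ ?_⟩
    · rw [injective_iff_map_eq_zero]
      intro x hx
      obtain ⟨y, rfl⟩ : ∃ y, K'.mkQ.baseChange _ y = x :=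
        LinearMap.lTensor_surjective _ K'.mkQ_surjective x
      obtain ⟨z, rfl⟩ := (hex y).1 (by rw [← hf, hx])
      obtain ⟨w, rfl⟩ : z ∈ K.baseChange (FractionRing R[X]) := hKtop ▸ Submodule.mem_top
      have h0 : K'.mkQ ∘ₗ (LinearMap.ker g).subtype ∘ₗ K.subtype = 0 := by
        ext k
        exact (Submodule.Quotient.mk_eq_zero K').2 ⟨k, k.2, rfl⟩
      rw [← LinearMap.comp_apply, ← LinearMap.comp_apply, ← LinearMap.baseChange_comp,
        ← LinearMap.baseChange_comp, LinearMap.comp_assoc, h0, LinearMap.baseChange_zero,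
        LinearMap.zero_apply]
    · obtain ⟨y, rfl⟩ := hgsurj x
      exact ⟨_, hf y⟩
end

section
/- Let R be a commutative ring and let N₁ and N₂ be submodules of an R-module M such that both N₁ and N₂ are τ_q-finitely presented. Then N₁ + N₂ is τ_q-finitely presented if and only if N₁ ∩ N₂ is τ_q-finitely generated. -/
open Polynomial TensorProduct

universe u v

/-- A module is *τ_q-finitely generated* if it has a finitely generated submodule
with Q-torsion quotient. -/
def IsTauQFG (R : Type u) (M : Type v) [CommRing R] [AddCommGroup M] [Module R M] : Prop :=
  ∃ N : Submodule R M, N.FG ∧ IsQTorsion R (M ⧸ N)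

namespace Ideal

variable {R : Type*} [CommRing R]

theorem isSemiregular_top : (⊤ : Ideal R).IsSemiregular := by
  refine ⟨⊤, le_rfl, Ideal.fg_top _, ?_⟩
  refine (Submodule.eq_bot_iff _).2 fun r hr ↦ ?_
  simpa using Submodule.mem_annihilator.1 hr 1 trivial

theorem IsSemiregular.mul {I J : Ideal R} (hI : I.IsSemiregular) (hJ : J.IsSemiregular) :
    (I * J).IsSemiregular := by
  obtain ⟨I', hI', hIfg, hIann⟩ := hI
  obtain ⟨J', hJ', hJfg, hJann⟩ := hJ
  refine ⟨I' * J', Ideal.mul_mono hI' hJ', Submodule.FG.mul hIfg hJfg, ?_⟩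
  refine (Submodule.eq_bot_iff _).2 fun r hr ↦ ?_
  rw [Submodule.mem_annihilator] at hr
  rw [← Submodule.mem_bot R, ← hIann, Submodule.mem_annihilator]
  intro a ha
  rw [← Submodule.mem_bot R, ← hJann, Submodule.mem_annihilator]
  intro b hb
  have := hr (a * b) (Ideal.mul_mem_mul ha hb)
  simpa only [smul_eq_mul, mul_assoc] using this

end Ideal

namespace Submodule

variable {R : Type*} [CommRing R] {X Y : Type*} [AddCommGroup X] [Module R X]
  [AddCommGroup Y] [Module R Y]

/-- The elements that a finitely generated semi-regular ideal multiplies into `B`. -/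
def qClosure (B : Submodule R X) : Submodule R X where
  carrier := {x | ∃ I : Ideal R, I.FG ∧ I.IsSemiregular ∧ ∀ a ∈ I, a • x ∈ B}
  zero_mem' := ⟨⊤, Ideal.fg_top _, Ideal.isSemiregular_top, fun a _ ↦ by simp⟩
  add_mem' := by
    rintro x y ⟨I, hI, hI', hIx⟩ ⟨J, hJ, hJ', hJy⟩
    refine ⟨I * J, hI.mul hJ, hI'.mul hJ', fun a ha ↦ ?_⟩
    rw [smul_add]
    exact B.add_mem (hIx a (Ideal.mul_le_left ha)) (hJy a (Ideal.mul_le_right ha))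
  smul_mem' := by
    rintro r x ⟨I, hI, hI', hIx⟩
    refine ⟨I, hI, hI', fun a ha ↦ ?_⟩
    rw [smul_comm]
    exact B.smul_mem r (hIx a ha)

theorem mem_qClosure {B : Submodule R X} {x : X} :
    x ∈ B.qClosure ↔ ∃ I : Ideal R, I.FG ∧ I.IsSemiregular ∧ ∀ a ∈ I, a • x ∈ B :=
  Iff.rfl

theorem le_qClosure (B : Submodule R X) : B ≤ B.qClosure := fun _ hx ↦
  ⟨⊤, Ideal.fg_top _, Ideal.isSemiregular_top, fun a _ ↦ B.smul_mem a hx⟩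

theorem qClosure_mono {B C : Submodule R X} (h : B ≤ C) : B.qClosure ≤ C.qClosure :=
  fun _ ⟨I, hI, hI', hIx⟩ ↦ ⟨I, hI, hI', fun a ha ↦ h (hIx a ha)⟩

theorem exists_ideal_of_fg_le_qClosure {A B : Submodule R X} (hA : A.FG) (h : A ≤ B.qClosure) :
    ∃ I : Ideal R, I.FG ∧ I.IsSemiregular ∧ I • A ≤ B := by
  induction A, hA using fg_induction with
  | singleton x =>
    obtain ⟨I, hI, hI', hIx⟩ := h (mem_span_singleton_self x)
    refine ⟨I, hI, hI', smul_le.2 fun a ha y hy ↦ ?_⟩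
    obtain ⟨r, rfl⟩ := mem_span_singleton.1 hy
    rw [smul_comm]
    exact B.smul_mem r (hIx a ha)
  | sup A₁ _ A₂ _ h₁ h₂ =>
    obtain ⟨I, hI, hI', hIA⟩ := h₁ (le_sup_left.trans h)
    obtain ⟨J, hJ, hJ', hJA⟩ := h₂ (le_sup_right.trans h)
    refine ⟨I * J, hI.mul hJ, hI'.mul hJ', ?_⟩
    rw [smul_sup]
    exact sup_le ((smul_mono_left Ideal.mul_le_left).trans hIA)
      ((smul_mono_left Ideal.mul_le_right).trans hJA)

theorem mem_qClosure_of_finset {B : Submodule R X} {x : X} {S : Finset R}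
    (hS : (Ideal.span (S : Set R)).IsSemiregular) (h : ∀ a ∈ S, a • x ∈ B.qClosure) :
    x ∈ B.qClosure := by
  have hle : Ideal.span (S : Set R) ≤ B.qClosure.comap (LinearMap.toSpanSingleton R X x) :=
    Ideal.span_le.2 fun a ha ↦ by simpa using h a ha
  obtain ⟨J, hJ, hJ', hJx⟩ := exists_ideal_of_fg_le_qClosure
    (A := Submodule.map (LinearMap.toSpanSingleton R X x) (Ideal.span (S : Set R)))
    ((fg_span S.finite_toSet).map _) (map_le_iff_le_comap.2 hle)
  refine ⟨J * Ideal.span (S : Set R), hJ.mul (fg_span S.finite_toSet), hJ'.mul hS,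
    fun a ha ↦ ?_⟩
  refine Submodule.mul_induction_on ha (fun j hj s hs ↦ ?_) fun a b ha hb ↦ ?_
  · rw [mul_smul]
    exact hJx (smul_mem_smul hj ⟨s, hs, by simp⟩)
  · rw [add_smul]
    exact B.add_mem ha hb

theorem mem_qClosure_of_ideal {B : Submodule R X} {x : X} {I : Ideal R} (hI : I.FG)
    (hI' : I.IsSemiregular) (h : ∀ a ∈ I, a • x ∈ B.qClosure) : x ∈ B.qClosure := by
  obtain ⟨S, rfl⟩ := hI
  exact mem_qClosure_of_finset hI' fun a ha ↦ h a (Ideal.subset_span ha)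

theorem qClosure_le_qClosure {B C : Submodule R X} (h : B ≤ C.qClosure) :
    B.qClosure ≤ C.qClosure :=
  fun _ ⟨_, hI, hI', hIx⟩ ↦ mem_qClosure_of_ideal hI hI' fun a ha ↦ h (hIx a ha)

theorem qClosure_inf_le (B C : Submodule R X) : B.qClosure ⊓ C.qClosure ≤ (B ⊓ C).qClosure := by
  rintro x ⟨⟨I, hI, hI', hIx⟩, ⟨J, hJ, hJ', hJx⟩⟩
  exact ⟨I * J, hI.mul hJ, hI'.mul hJ', fun a ha ↦
    ⟨hIx a (Ideal.mul_le_left ha), hJx a (Ideal.mul_le_right ha)⟩⟩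

theorem map_qClosure_le (f : X →ₗ[R] Y) (B : Submodule R X) :
    B.qClosure.map f ≤ (B.map f).qClosure := by
  rintro _ ⟨x, ⟨I, hI, hI', hIx⟩, rfl⟩
  exact ⟨I, hI, hI', fun a ha ↦ ⟨a • x, hIx a ha, by simp⟩⟩

theorem comap_qClosure (f : X →ₗ[R] Y) (B : Submodule R Y) :
    B.qClosure.comap f = (B.comap f).qClosure := by
  ext x
  simp [mem_qClosure]

theorem isQTorsion_quotient_iff {B : Submodule R X} : IsQTorsion R (X ⧸ B) ↔ B.qClosure = ⊤ := by
  rw [eq_top_iff']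
  refine B.mkQ_surjective.forall.trans (forall_congr' fun x ↦ ?_)
  simp only [mem_qClosure, mkQ_apply, ← Quotient.mk_smul, Quotient.mk_eq_zero]

theorem isQTorsion_iff_le_qClosure_bot {A : Submodule R X} :
    IsQTorsion R A ↔ A ≤ (⊥ : Submodule R X).qClosure := by
  simp [IsQTorsion, SetLike.le_def, mem_qClosure, Subtype.ext_iff]

/-- A submodule is finitely generated up to `Q`-torsion. -/
def IsQFG (A : Submodule R X) : Prop :=
  ∃ B ≤ A, B.FG ∧ A ≤ B.qClosure

theorem isTauQFG_iff {A : Submodule R X} : IsTauQFG R A ↔ A.IsQFG := by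
  constructor
  · rintro ⟨N, hN, hNt⟩
    rw [isQTorsion_quotient_iff] at hNt
    refine ⟨N.map A.subtype, map_subtype_le _ _, hN.map _, ?_⟩
    calc A = N.qClosure.map A.subtype := by simp [hNt]
      _ ≤ _ := map_qClosure_le _ _
  · rintro ⟨B, hBA, hB, hAB⟩
    refine ⟨B.comap A.subtype, fg_of_fg_map_injective A.subtype A.subtype_injective ?_, ?_⟩
    · rwa [map_comap_subtype, inf_eq_right.2 hBA]
    · rw [isQTorsion_quotient_iff, ← comap_qClosure, comap_subtype_eq_top]
      exact hAB

theorem IsQFG.of_le_of_le_qClosure {A B : Submodule R X} (hA : A.IsQFG) (hBA : B ≤ A)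
    (hAB : A ≤ B.qClosure) : B.IsQFG := by
  obtain ⟨C, hCA, hC, hAC⟩ := hA
  obtain ⟨I, hI, hI', hIC⟩ := exists_ideal_of_fg_le_qClosure hC (hCA.trans hAB)
  refine ⟨I • C, hIC, Submodule.FG.smul hI hC, hBA.trans (hAC.trans (qClosure_le_qClosure fun x hx ↦ ?_))⟩
  exact ⟨I, hI, hI', fun a ha ↦ smul_mem_smul ha hx⟩

theorem IsQFG.of_le_qClosure_of_le {A B : Submodule R X} (hB : B.IsQFG) (hBA : B ≤ A)
    (hAB : A ≤ B.qClosure) : A.IsQFG := by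
  obtain ⟨C, hCB, hC, hBC⟩ := hB
  exact ⟨C, hCB.trans hBA, hC, hAB.trans (qClosure_le_qClosure hBC)⟩

theorem IsQFG.map {A : Submodule R X} (hA : A.IsQFG) (f : X →ₗ[R] Y) : (A.map f).IsQFG := by
  obtain ⟨B, hBA, hB, hAB⟩ := hA
  exact ⟨B.map f, map_mono hBA, hB.map f, (map_mono hAB).trans (map_qClosure_le f B)⟩

theorem exists_fg_le_map_eq {A : Submodule R X} {f : X →ₗ[R] Y} {C : Submodule R Y}
    (hC : C.FG) (h : C ≤ A.map f) : ∃ B ≤ A, B.FG ∧ B.map f = C := by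
  induction C, hC using fg_induction with
  | singleton y =>
    obtain ⟨x, hx, rfl⟩ := h (mem_span_singleton_self y)
    exact ⟨R ∙ x, by simpa using hx, fg_span_singleton x, by simp [map_span]⟩
  | sup C₁ _ C₂ _ h₁ h₂ =>
    obtain ⟨B₁, hB₁, hfg₁, rfl⟩ := h₁ (le_sup_left.trans h)
    obtain ⟨B₂, hB₂, hfg₂, rfl⟩ := h₂ (le_sup_right.trans h)
    exact ⟨B₁ ⊔ B₂, sup_le hB₁ hB₂, hfg₁.sup hfg₂, map_sup _ _ _⟩

theorem IsQFG.of_map {A : Submodule R X} {f : X →ₗ[R] Y}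
    (hker : A ⊓ LinearMap.ker f ≤ (⊥ : Submodule R X).qClosure) (h : (A.map f).IsQFG) :
    A.IsQFG := by
  obtain ⟨C, hCA, hC, hAC⟩ := h
  obtain ⟨B, hBA, hB, rfl⟩ := exists_fg_le_map_eq hC hCA
  refine ⟨B, hBA, hB, fun x hx ↦ ?_⟩
  obtain ⟨I, hI, hI', hIx⟩ := hAC ⟨x, hx, rfl⟩
  refine mem_qClosure_of_ideal hI hI' fun a ha ↦ ?_
  obtain ⟨b, hb, hba⟩ := hIx a ha
  have hmem : a • x - b ∈ B.qClosure := by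
    refine qClosure_mono bot_le (hker ⟨A.sub_mem (A.smul_mem a hx) (hBA hb), ?_⟩)
    simp [hba]
  simpa using B.qClosure.add_mem hmem (B.le_qClosure hb)

end Submodule

open Submodule

theorem Module.exists_comp_eq_smul {R F G M : Type*} [CommRing R] [AddCommGroup F] [Module R F]
    [AddCommGroup G] [Module R G] [AddCommGroup M] [Module R M] [Module.Projective R F]
    {p : F →ₗ[R] M} {g : G →ₗ[R] M} {I : Ideal R}
    (h : I • LinearMap.range p ≤ LinearMap.range g) {a : R} (ha : a ∈ I) :
    ∃ s : F →ₗ[R] G, g ∘ₗ s = a • p := by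
  have hmem (x : F) : (a • p) x ∈ LinearMap.range g := h (smul_mem_smul ha ⟨x, rfl⟩)
  obtain ⟨s, hs⟩ := Module.projective_lifting_property g.rangeRestrict
    ((a • p).codRestrict _ hmem) g.surjective_rangeRestrict
  refine ⟨s, LinearMap.ext fun x ↦ ?_⟩
  simpa [Subtype.ext_iff] using LinearMap.congr_fun hs x

theorem LinearMap.isQFG_ker_of_range_le_qClosure {R F G M : Type*} [CommRing R]
    [AddCommGroup F] [Module R F] [AddCommGroup G] [Module R G] [AddCommGroup M] [Module R M]
    [Module.Projective R F] [Module.Finite R F] [Module.Projective R G] [Module.Finite R G]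
    {p : F →ₗ[R] M} {g : G →ₗ[R] M} (hpg : range p ≤ (range g).qClosure)
    (hgp : range g ≤ (range p).qClosure) (hp : (ker p).IsQFG) : (ker g).IsQFG := by
  obtain ⟨_, ⟨S, rfl⟩, hS, hSp⟩ := exists_ideal_of_fg_le_qClosure (fg_range p) hpg
  obtain ⟨_, ⟨T, rfl⟩, hT, hTg⟩ := exists_ideal_of_fg_le_qClosure (fg_range g) hgp
  obtain ⟨K, hKp, hK, hpK⟩ := hp
  choose s hs using fun a : S ↦ Module.exists_comp_eq_smul hSp (subset_span a.2)
  choose c hc using fun b : T ↦ Module.exists_comp_eq_smul hTg (subset_span b.2)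
  replace hs (a : S) (x : F) : g (s a x) = a.1 • p x := LinearMap.congr_fun (hs a) x
  replace hc (b : T) (x : G) : p (c b x) = b.1 • g x := LinearMap.congr_fun (hc b) x
  let C (a : S) (b : T) : Submodule R G :=
    range ((a.1 * b.1) • LinearMap.id - s a ∘ₗ c b) ⊔ K.map (s a)
  refine ⟨⨆ a, ⨆ b, C a b, ?_, ?_, fun x hx ↦ ?_⟩
  · refine iSup_le fun a ↦ iSup_le fun b ↦ sup_le ?_ ?_
    · rintro _ ⟨x, rfl⟩
      simp [hs, hc, mul_smul]
    · rintro _ ⟨x, hx, rfl⟩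
      have := mem_ker.1 (hKp hx)
      simp [hs, this]
  · exact fg_iSup _ fun a ↦ fg_iSup _ fun b ↦ (fg_range _).sup (hK.map _)
  · refine mem_qClosure_of_finset hS fun a ha ↦ mem_qClosure_of_finset hT fun b hb ↦ ?_
    refine qClosure_mono ((le_iSup (C ⟨a, ha⟩) ⟨b, hb⟩).trans (le_iSup (fun a ↦ ⨆ b, C a b) _)) ?_
    have h₁ : (a * b) • x - s ⟨a, ha⟩ (c ⟨b, hb⟩ x) ∈ (C ⟨a, ha⟩ ⟨b, hb⟩).qClosure :=
      le_qClosure _ (mem_sup_left ⟨x, by simp⟩)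
    have h₂ : s ⟨a, ha⟩ (c ⟨b, hb⟩ x) ∈ (C ⟨a, ha⟩ ⟨b, hb⟩).qClosure := by
      refine qClosure_mono le_sup_right (map_qClosure_le _ _ ⟨_, hpK ?_, rfl⟩)
      simp [hc, mem_ker.1 hx]
    have := add_mem h₁ h₂
    rwa [sub_add_cancel, mul_comm, mul_smul] at this

section TauQFP

variable {R : Type u} [CommRing R] {M : Type v} [AddCommGroup M] [Module R M]

theorem Submodule.isTauQFP_iff {N : Submodule R M} :
    IsTauQFP R N ↔ ∃ (F : Type v) (_ : AddCommGroup F) (_ : Module R F) (f : F →ₗ[R] M),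
      Module.FinitePresentation R F ∧ LinearMap.ker f ≤ (⊥ : Submodule R F).qClosure ∧
        LinearMap.range f ≤ N ∧ N ≤ (LinearMap.range f).qClosure := by
  constructor
  · rintro ⟨F, _, _, f, hF, hker, hrange⟩
    rw [isQTorsion_iff_le_qClosure_bot] at hker
    rw [isQTorsion_quotient_iff] at hrange
    refine ⟨F, _, _, N.subtype ∘ₗ f, hF, by rwa [LinearMap.ker_comp, ker_subtype], ?_, ?_⟩
    · rw [LinearMap.range_comp]
      exact map_subtype_le _ _
    · calc N = (LinearMap.range f).qClosure.map N.subtype := by simp [hrange]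
        _ ≤ _ := map_qClosure_le _ _
        _ = _ := by rw [LinearMap.range_comp]
  · rintro ⟨F, _, _, f, hF, hker, hle, hrange⟩
    refine ⟨F, _, _, f.codRestrict N fun x ↦ hle ⟨x, rfl⟩, hF, ?_, ?_⟩
    · rwa [isQTorsion_iff_le_qClosure_bot, LinearMap.ker_codRestrict]
    · rwa [isQTorsion_quotient_iff, LinearMap.range_codRestrict, ← comap_qClosure,
        comap_subtype_eq_top]

theorem Submodule.isTauQFP_of_isQFG_ker {N : Submodule R M} {F : Type v} [AddCommGroup F]
    [Module R F] [Module.FinitePresentation R F] {g : F →ₗ[R] M} (hg : LinearMap.range g ≤ N)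
    (hN : N ≤ (LinearMap.range g).qClosure) (hker : (LinearMap.ker g).IsQFG) : IsTauQFP R N := by
  obtain ⟨B, hB, hBfg, hker⟩ := hker
  refine isTauQFP_iff.2 ⟨F ⧸ B, _, _, B.liftQ g hB, ?_, ?_, ?_, ?_⟩
  · exact Module.finitePresentation_of_surjective B.mkQ B.mkQ_surjective (by simpa using hBfg)
  · rw [ker_liftQ]
    refine (map_mono hker).trans ((map_qClosure_le _ _).trans (qClosure_mono ?_))
    simp
  · rwa [range_liftQ]
  · rwa [range_liftQ]

theorem Submodule.isQFG_ker_of_isTauQFP {N : Submodule R M} {F : Type*} [AddCommGroup F]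
    [Module R F] [Module.Finite R F] {g : F →ₗ[R] M} (hg : LinearMap.range g ≤ N)
    (hN : N ≤ (LinearMap.range g).qClosure) (hFP : IsTauQFP R N) : (LinearMap.ker g).IsQFG := by
  obtain ⟨E, _, _, h, hE, hker, hh, hNh⟩ := isTauQFP_iff.1 hFP
  obtain ⟨n, π, hπ⟩ := Module.Finite.exists_fin' R E
  obtain ⟨k, q, hq⟩ := Module.Finite.exists_fin' R F
  have hrπ : LinearMap.range (h ∘ₗ π) = LinearMap.range h :=
    LinearMap.range_comp_of_range_eq_top _ (LinearMap.range_eq_top.2 hπ)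
  have hrq : LinearMap.range (g ∘ₗ q) = LinearMap.range g :=
    LinearMap.range_comp_of_range_eq_top _ (LinearMap.range_eq_top.2 hq)
  have hkerπ : (LinearMap.ker (h ∘ₗ π)).IsQFG := by
    have hle : LinearMap.ker π ≤ LinearMap.ker (h ∘ₗ π) := LinearMap.ker_le_ker_comp _ _
    refine ⟨LinearMap.ker π, hle, Module.FinitePresentation.fg_ker π hπ, ?_⟩
    rw [LinearMap.ker_comp]
    exact (comap_mono hker).trans (comap_qClosure _ _).le
  have hkerq : (LinearMap.ker (g ∘ₗ q)).IsQFG := by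
    refine LinearMap.isQFG_ker_of_range_le_qClosure (p := h ∘ₗ π) ?_ ?_ hkerπ
    · rw [hrπ, hrq]
      exact hh.trans hN
    · rw [hrπ, hrq]
      exact hg.trans hNh
  have := hkerq.map q
  rwa [LinearMap.ker_comp, map_comap_eq_of_surjective hq] at this

end TauQFP

/-- If `N₁` and `N₂` are τ_q-finitely presented submodules of a module `M`, then
`N₁ + N₂` is τ_q-finitely presented if and only if `N₁ ∩ N₂` is τ_q-finitely
generated. -/
theorem statement7 (R : Type u) [CommRing R] (M : Type v) [AddCommGroup M] [Module R M]
    (N₁ N₂ : Submodule R M) (h1 : IsTauQFP R N₁) (h2 : IsTauQFP R N₂) :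
    IsTauQFP R ↥(N₁ ⊔ N₂) ↔ IsTauQFG R ↥(N₁ ⊓ N₂) := by
  obtain ⟨F₁, _, _, f₁, hF₁, hker₁, hf₁, hN₁⟩ := isTauQFP_iff.1 h1
  obtain ⟨F₂, _, _, f₂, hF₂, hker₂, hf₂, hN₂⟩ := isTauQFP_iff.1 h2
  let g : F₁ × F₂ →ₗ[R] M := f₁.coprod f₂
  have hg : LinearMap.range g = LinearMap.range f₁ ⊔ LinearMap.range f₂ := LinearMap.range_coprod _ _
  have hgN : LinearMap.range g ≤ N₁ ⊔ N₂ := hg.trans_le (sup_le_sup hf₁ hf₂)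
  have hNg : N₁ ⊔ N₂ ≤ (LinearMap.range g).qClosure := by
    rw [hg]
    exact sup_le (hN₁.trans (qClosure_mono le_sup_left)) (hN₂.trans (qClosure_mono le_sup_right))
  have hiff : IsTauQFP R ↥(N₁ ⊔ N₂) ↔ (LinearMap.ker g).IsQFG :=
    ⟨isQFG_ker_of_isTauQFP hgN hNg, isTauQFP_of_isQFG_ker hgN hNg⟩
  let ψ : F₁ × F₂ →ₗ[R] M := f₁ ∘ₗ LinearMap.fst R F₁ F₂
  have hmap : (LinearMap.ker g).map ψ = LinearMap.range f₁ ⊓ LinearMap.range f₂ := by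
    refine le_antisymm ?_ ?_
    · rintro _ ⟨⟨x, y⟩, hxy, rfl⟩
      have hxy : f₁ x + f₂ y = 0 := by simpa [g] using hxy
      exact ⟨⟨x, rfl⟩, -y, by simpa [ψ] using (eq_neg_of_add_eq_zero_left hxy).symm⟩
    · rintro _ ⟨⟨x, rfl⟩, y, hy⟩
      exact ⟨(x, -y), by simp [g, hy], rfl⟩
  have hker : LinearMap.ker g ⊓ LinearMap.ker ψ ≤ (⊥ : Submodule R (F₁ × F₂)).qClosure := by
    rintro ⟨x, y⟩ ⟨hx, hy⟩
    have hx₁ : f₁ x = 0 := hy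
    have hy₂ : f₂ y = 0 := by simpa [g, hx₁] using hx
    have h₁ := map_qClosure_le (LinearMap.inl R F₁ F₂) ⊥ ⟨x, hker₁ hx₁, rfl⟩
    have h₂ := map_qClosure_le (LinearMap.inr R F₁ F₂) ⊥ ⟨y, hker₂ hy₂, rfl⟩
    rw [Submodule.map_bot] at h₁ h₂
    simpa using add_mem h₁ h₂
  have hle := inf_le_inf hf₁ hf₂
  have hcl := (inf_le_inf hN₁ hN₂).trans (qClosure_inf_le _ _)
  rw [hiff, isTauQFG_iff]
  refine ⟨fun h ↦ ?_, fun h ↦ .of_map hker ?_⟩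
  · exact IsQFG.of_le_qClosure_of_le (hmap ▸ h.map ψ) hle hcl
  · rw [hmap]
    exact h.of_le_of_le_qClosure hle hcl
end

section
/- Let R be a commutative ring. Every R-module is τ_q-flat if and only if R is a reduced ring and the set Min(R) of minimal prime ideals of R, equipped with the subspace topology from the Zariski topology on the prime spectrum Spec(R), is compact. -/
open Polynomial TensorProduct

universe u v

open CategoryTheory in
/-- `Tor_1^R(M, N)` as an `R`-module. -/
noncomputable def Tor1Mod (R : Type u) [CommRing R] (M N : Type u)
    [AddCommGroup M] [Module R M] [AddCommGroup N] [Module R N] : ModuleCat R :=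
  ((Tor (ModuleCat.{u} R) 1).obj (ModuleCat.of R M)).obj (ModuleCat.of R N)

/-- A module is *τ_q-flat* if `Tor_1^R(M, N)` is Q-torsion for every module `N`. -/
def IsTauQFlat (R : Type u) [CommRing R] (M : Type u) [AddCommGroup M] [Module R M] : Prop :=
  ∀ (N : Type u) [AddCommGroup N] [Module R N], IsQTorsion R (Tor1Mod R M N)


open CategoryTheory in
/-- `Tor_1^R(M, N)` is the first homology of `M ⊗ P` for a projective resolution `P` of `N`, so it
is Q-torsion exactly when each 1-cycle is multiplied into the boundaries by a finitely generated
semi-regular ideal. -/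
theorem exists_exact_isQTorsion_tor1Mod_iff (R : Type u) [CommRing R] (M N : Type u)
    [AddCommGroup M] [Module R M] [AddCommGroup N] [Module R N] :
    ∃ (P₂ P₁ P₀ : ModuleCat.{u} R) (d₂ : P₂ →ₗ[R] P₁) (d₁ : P₁ →ₗ[R] P₀) (ε : P₀ →ₗ[R] N),
      Module.Projective R P₀ ∧ Function.Exact d₂ d₁ ∧ Function.Exact d₁ ε ∧
      Function.Surjective ε ∧
      (IsQTorsion R (Tor1Mod R M N) ↔ ∀ z : M ⊗[R] P₁, d₁.lTensor M z = 0 →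
        ∃ I : Ideal R, I.FG ∧ I.IsSemiregular ∧
          ∀ a ∈ I, a • z ∈ LinearMap.range (d₂.lTensor M)) := by
  obtain ⟨P⟩ : Nonempty (ProjectiveResolution (ModuleCat.of R N)) :=
    HasProjectiveResolution.out
  let F := (MonoidalCategory.tensoringLeft (ModuleCat.{u} R)).obj (ModuleCat.of R M)
  let K := (F.mapHomologicalComplex (ComplexShape.down ℕ)).obj P.complex
  let S := K.sc' 2 1 0
  let e : S.moduleCatLeftHomologyData.H ≅ Tor1Mod R M N :=
    S.moduleCatHomologyIso.symm ≪≫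
      ShortComplex.homologyMapIso (K.isoSc' 2 1 0 (by simp) (by simp)).symm ≪≫
      (P.isoLeftDerivedObj F 1).symm
  let q : LinearMap.ker S.g.hom →ₗ[R] Tor1Mod R M N :=
    e.toLinearEquiv.toLinearMap ∘ₗ (LinearMap.range S.moduleCatToCycles).mkQ
  have hq : Function.Surjective q := e.toLinearEquiv.surjective.comp (Submodule.mkQ_surjective _)
  have hq0 (z : LinearMap.ker S.g.hom) (a : R) :
      a • q z = 0 ↔ a • z.1 ∈ LinearMap.range S.f.hom := by
    rw [← map_smul]
    refine (e.toLinearEquiv.map_eq_zero_iff).trans ?_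
    refine (Submodule.Quotient.mk_eq_zero _).trans ?_
    constructor
    · rintro ⟨w, hw⟩
      exact ⟨w, congrArg Subtype.val hw⟩
    · rintro ⟨w, hw⟩
      exact ⟨w, Subtype.ext hw⟩
  refine ⟨P.complex.X 2, P.complex.X 1, P.complex.X 0, (P.complex.d 2 1).hom,
    (P.complex.d 1 0).hom, (P.π.f 0).hom, ?_, ?_, ?_, ?_, ?_⟩
  · exact (IsProjective.iff_projective _).mpr (P.projective 0)
  · exact (ShortComplex.ShortExact.moduleCat_exact_iff_function_exact _).mp (P.exact_succ 0)
  · exact (ShortComplex.ShortExact.moduleCat_exact_iff_function_exact _).mp P.exact₀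
  · exact (ModuleCat.epi_iff_surjective (P.π.f 0)).mp inferInstance
  · constructor
    · intro h z hz
      obtain ⟨I, hI, hI', hz'⟩ := h (q ⟨z, hz⟩)
      exact ⟨I, hI, hI', fun a ha ↦ (hq0 ⟨z, hz⟩ a).mp (hz' a ha)⟩
    · intro h m
      obtain ⟨z, rfl⟩ := hq m
      obtain ⟨I, hI, hI', hz'⟩ := h z.1 z.2
      exact ⟨I, hI, hI', fun a ha ↦ (hq0 z a).mpr (hz' a ha)⟩

theorem Ideal.IsSemiregular.annihilator_eq_bot {R : Type*} [CommRing R] {I : Ideal R}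
    (h : I.IsSemiregular) : Submodule.annihilator I = ⊥ := by
  obtain ⟨J, hJI, -, hJ⟩ := h
  exact le_bot_iff.mp (hJ ▸ Submodule.annihilator_mono hJI)

/-- In a reduced ring, an ideal contained in no minimal prime is dense. -/
theorem Ideal.annihilator_eq_bot_of_not_le_minimalPrimes {R : Type*} [CommRing R] [IsReduced R]
    {J : Ideal R} (h : ∀ p ∈ minimalPrimes R, ¬ J ≤ p) : Submodule.annihilator J = ⊥ := by
  have hbot : sInf (minimalPrimes R) = ⊥ :=
    Ideal.sInf_minimalPrimes.trans (nilradical_eq_zero R)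
  rw [← le_bot_iff, ← hbot]
  refine le_sInf fun p hp c hc ↦ ?_
  have := hp.isPrime
  obtain ⟨b, hb, hbp⟩ := Set.not_subset.mp (h p hp)
  have hcb : c * b = 0 := Submodule.mem_annihilator.mp hc b hb
  exact (this.mem_or_mem (hcb ▸ p.zero_mem)).resolve_right hbp

/-- In a reduced ring, elements of a minimal prime are annihilated by an element outside it. -/
theorem exists_mul_eq_zero_of_mem_minimalPrimes {R : Type*} [CommRing R] [IsReduced R]
    {p : Ideal R} (hp : p ∈ minimalPrimes R) {x : R} (hx : x ∈ p) : ∃ s ∉ p, s * x = 0 := by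
  have := hp.isPrime
  have h := IsLocalization.AtPrime.radical_map_of_mem_minimalPrimes
    (Localization.AtPrime p) p ⊥ hp
  have hx' : algebraMap R (Localization.AtPrime p) x ∈ p.map (algebraMap R _) :=
    Ideal.mem_map_of_mem _ hx
  rw [← h, Ideal.map_bot, Ideal.mem_radical_iff] at hx'
  obtain ⟨n, hn⟩ := hx'
  rw [Ideal.mem_bot, ← map_pow, IsLocalization.map_eq_zero_iff p.primeCompl] at hn
  obtain ⟨s, hs⟩ := hn
  refine ⟨s, s.2, (pow_eq_zero_iff (n.add_one_ne_zero)).mp ?_⟩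
  linear_combination (s : R) ^ n * x * hs

/-- In a reduced ring, a finitely generated dense ideal lies in no minimal prime. -/
theorem Ideal.FG.not_le_of_mem_minimalPrimes {R : Type*} [CommRing R] [IsReduced R]
    {J : Ideal R} (hJ : J.FG) (hJ' : Submodule.annihilator J = ⊥) {p : Ideal R}
    (hp : p ∈ minimalPrimes R) : ¬ J ≤ p := by
  classical
  intro hle
  have hprime := hp.isPrime
  obtain ⟨t, rfl⟩ := hJ
  choose! s hsp hs using fun x hx ↦ exists_mul_eq_zero_of_mem_minimalPrimes (x := x) hp hx
  have hmem : ∏ x ∈ t, s x ∈ Submodule.annihilator (Ideal.span (t : Set R)) := by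
    refine (Submodule.mem_annihilator_span _ _).mpr fun ⟨x, hx⟩ ↦ ?_
    rw [← Finset.prod_erase_mul t s hx, smul_eq_mul, mul_assoc, hs x (hle (subset_span hx)),
      mul_zero]
  rw [hJ', Ideal.mem_bot] at hmem
  obtain ⟨x, hx, hxp⟩ := hprime.prod_mem_iff.mp (hmem ▸ p.zero_mem : ∏ x ∈ t, s x ∈ p)
  exact hsp x (hle (subset_span hx)) hxp

/-- The localization of a reduced ring at a minimal prime is a field. -/
theorem isField_localization_of_mem_minimalPrimes {R : Type*} [CommRing R] [IsReduced R]
    {p : Ideal R} [p.IsPrime] (hp : p ∈ minimalPrimes R) : IsField (Localization.AtPrime p) := by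
  refine (IsLocalRing.isField_iff_maximalIdeal_eq).mpr ?_
  rw [← IsLocalization.AtPrime.map_eq_maximalIdeal p (Localization.AtPrime p),
    ← IsLocalization.AtPrime.radical_map_of_mem_minimalPrimes _ p ⊥ hp, Ideal.map_bot]
  have : IsReduced (Localization.AtPrime p) :=
    isReduced_localizationPreserves p.primeCompl _ ‹_›
  exact nilradical_eq_zero _

theorem flat_localization_tensorProduct_of_mem_minimalPrimes {R : Type u} [CommRing R]
    [IsReduced R] {p : Ideal R} [p.IsPrime] (hp : p ∈ minimalPrimes R) (M : Type u)
    [AddCommGroup M] [Module R M] : Module.Flat R (Localization.AtPrime p ⊗[R] M) := by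
  have : Module.Flat (Localization.AtPrime p) (Localization.AtPrime p ⊗[R] M) := by
    let := (isField_localization_of_mem_minimalPrimes hp).toField
    infer_instance
  exact Module.Flat.trans R (Localization.AtPrime p) _

/-- Flatness of `R_p ⊗ M` lets a 1-cycle of `M ⊗ P` be moved into the boundaries by an element
outside `p`. -/
theorem exists_smul_mem_range_lTensor {R : Type u} [CommRing R] (p : Ideal R) [p.IsPrime]
    {M P₂ P₁ P₀ : Type u} [AddCommGroup M] [Module R M] [AddCommGroup P₂] [Module R P₂]
    [AddCommGroup P₁] [Module R P₁] [AddCommGroup P₀] [Module R P₀]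
    [Module.Flat R (Localization.AtPrime p ⊗[R] M)]
    {d₂ : P₂ →ₗ[R] P₁} {d₁ : P₁ →ₗ[R] P₀} (hd : Function.Exact d₂ d₁) {z : M ⊗[R] P₁}
    (hz : d₁.lTensor M z = 0) : ∃ s ∉ p, s • z ∈ LinearMap.range (d₂.lTensor M) := by
  let L := Localization.AtPrime p
  let α (X : Type u) [AddCommGroup X] [Module R X] := TensorProduct.assoc R L M X
  have hα {X Y : Type u} [AddCommGroup X] [Module R X] [AddCommGroup Y] [Module R Y]
      (f : X →ₗ[R] Y) (w : (L ⊗[R] M) ⊗[R] X) :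
      α Y (f.lTensor (L ⊗[R] M) w) = (f.lTensor M).lTensor L (α X w) := by
    have : (α Y).toLinearMap ∘ₗ f.lTensor (L ⊗[R] M) =
        (f.lTensor M).lTensor L ∘ₗ (α X).toLinearMap :=
      TensorProduct.ext_threefold fun _ _ _ ↦ rfl
    exact LinearMap.congr_fun this w
  have hz' : d₁.lTensor (L ⊗[R] M) ((α P₁).symm (1 ⊗ₜ z)) = 0 := by
    apply (α P₀).injective
    rw [hα, LinearEquiv.apply_symm_apply, LinearMap.lTensor_tmul, hz, tmul_zero, map_zero]
  obtain ⟨w, hw⟩ := (Module.Flat.lTensor_exact (L ⊗[R] M) hd _).mp hz'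
  obtain ⟨⟨w', s⟩, hs⟩ := IsLocalizedModule.surj p.primeCompl
    (TensorProduct.mk R L (M ⊗[R] P₂) 1) (α P₂ w)
  have key : TensorProduct.mk R L (M ⊗[R] P₁) 1 (s • z) =
      TensorProduct.mk R L (M ⊗[R] P₁) 1 (d₂.lTensor M w') := by
    have h1 := congrArg ((d₂.lTensor M).lTensor L) hs
    rw [Submonoid.smul_def, map_smul, ← hα, hw, LinearEquiv.apply_symm_apply] at h1
    rw [Submonoid.smul_def, map_smul]
    exact h1
  obtain ⟨t, ht⟩ := (IsLocalizedModule.eq_iff_exists p.primeCompl _).mp key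
  refine ⟨t * s, (t * s).2, t.1 • w', ?_⟩
  rw [map_smul, mul_smul]
  exact ht.symm

/-- If the minimal spectrum of a reduced ring is compact, an ideal contained in no minimal prime
contains a finitely generated dense ideal. -/
theorem Ideal.exists_fg_le_annihilator_eq_bot {R : Type*} [CommRing R] [IsReduced R]
    [CompactSpace {p : PrimeSpectrum R // p.asIdeal ∈ minimalPrimes R}] {A : Ideal R}
    (hA : ∀ p ∈ minimalPrimes R, ¬ A ≤ p) :
    ∃ J ≤ A, J.FG ∧ Submodule.annihilator J = ⊥ := by
  obtain ⟨t, ht⟩ := isCompact_univ.elim_finite_subcover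
    (fun a : A ↦ (Subtype.val ⁻¹' (PrimeSpectrum.basicOpen (a : R) : Set (PrimeSpectrum R)) :
      Set {p : PrimeSpectrum R // p.asIdeal ∈ minimalPrimes R}))
    (fun a ↦ (PrimeSpectrum.basicOpen (a : R)).isOpen.preimage continuous_subtype_val)
    (fun p _ ↦ by
      obtain ⟨a, ha, hap⟩ := Set.not_subset.mp (hA _ p.2)
      exact Set.mem_iUnion.mpr ⟨⟨a, ha⟩, hap⟩)
  refine ⟨Ideal.span (Subtype.val '' (t : Set A)), ?_, ?_, ?_⟩
  · rw [Ideal.span_le]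
    rintro _ ⟨a, -, rfl⟩
    exact a.2
  · exact Submodule.fg_span (t.finite_toSet.image _)
  · refine Ideal.annihilator_eq_bot_of_not_le_minimalPrimes fun p hp hle ↦ ?_
    obtain ⟨a, hat, hap⟩ := Set.mem_iUnion₂.mp
      (ht (Set.mem_univ ⟨⟨p, hp.isPrime⟩, hp⟩))
    exact hap (hle (Ideal.subset_span ⟨a, hat, rfl⟩))

theorem isTauQFlat_of_compactSpace_minimalPrimes {R : Type u} [CommRing R] [IsReduced R]
    [CompactSpace {p : PrimeSpectrum R // p.asIdeal ∈ minimalPrimes R}]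
    (M : Type u) [AddCommGroup M] [Module R M] : IsTauQFlat R M := by
  intro N _ _
  obtain ⟨P₂, P₁, P₀, d₂, d₁, ε, -, hd, -, -, h⟩ := exists_exact_isQTorsion_tor1Mod_iff R M N
  refine h.mpr fun z hz ↦ ?_
  let A : Ideal R := (LinearMap.range (d₂.lTensor M)).comap (LinearMap.toSpanSingleton R _ z)
  obtain ⟨J, hJA, hJ, hJ'⟩ := Ideal.exists_fg_le_annihilator_eq_bot (A := A) fun p hp hle ↦ by
    have := hp.isPrime
    have := flat_localization_tensorProduct_of_mem_minimalPrimes hp M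
    obtain ⟨s, hsp, hs⟩ := exists_smul_mem_range_lTensor p hd hz
    exact hsp (hle hs)
  exact ⟨J, hJ, ⟨J, le_rfl, hJ, hJ'⟩, hJA⟩

theorem exists_smul_eq_of_one_tmul_eq_zero {R X : Type*} [CommRing R] [AddCommGroup X] [Module R X]
    {a : R} {x : X} (h : (1 : R ⧸ Ideal.span {a}) ⊗ₜ[R] x = 0) : ∃ v, a • v = x := by
  have h' := congrArg (TensorProduct.quotTensorEquivQuotSMul X (Ideal.span {a})) h
  rw [TensorProduct.quotTensorEquivQuotSMul_mk_one_tmul, map_zero,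
    Submodule.Quotient.mk_eq_zero, Submodule.ideal_span_singleton_smul] at h'
  obtain ⟨v, -, hv⟩ := h'
  exact ⟨v, hv⟩

theorem one_tmul_smul_eq_zero {R X : Type*} [CommRing R] [AddCommGroup X] [Module R X]
    (a : R) (x : X) : (1 : R ⧸ Ideal.span {a}) ⊗ₜ[R] (a • x) = 0 := by
  rw [← smul_tmul, Algebra.smul_def, mul_one, Ideal.Quotient.algebraMap_eq,
    Ideal.Quotient.mk_singleton_self, zero_tmul]

/-- For a projective presentation of `R/aR`, there is a 1-cycle of `R/aR ⊗ P` such that every `i`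
multiplying it into the boundaries satisfies `i * a ∈ a²R`. -/
theorem exists_cycle_quotient_span_singleton {R : Type*} [CommRing R] (a : R)
    {P₂ P₁ P₀ : Type*} [AddCommGroup P₂] [Module R P₂] [AddCommGroup P₁] [Module R P₁]
    [AddCommGroup P₀] [Module R P₀] [Module.Projective R P₀]
    {d₂ : P₂ →ₗ[R] P₁} {d₁ : P₁ →ₗ[R] P₀} {ε : P₀ →ₗ[R] R ⧸ Ideal.span {a}}
    (hd : Function.Exact d₂ d₁) (hd' : Function.Exact d₁ ε) (hε : Function.Surjective ε) :
    ∃ z : (R ⧸ Ideal.span {a}) ⊗[R] P₁, d₁.lTensor (R ⧸ Ideal.span {a}) z = 0 ∧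
      ∀ i : R, i • z ∈ LinearMap.range (d₂.lTensor (R ⧸ Ideal.span {a})) →
        ∃ r, i * a = a * a * r := by
  obtain ⟨f, hf⟩ := Module.projective_lifting_property (Ideal.span {a}).mkQ ε
    (Submodule.mkQ_surjective _)
  replace hf (x : P₀) : Ideal.Quotient.mk (Ideal.span {a}) (f x) = ε x := LinearMap.congr_fun hf x
  have hmem {x : P₀} {c : R} (hx : ε x = Ideal.Quotient.mk _ c) : ∃ t, f x = c + a * t := by
    rw [← hf, Ideal.Quotient.eq, Ideal.mem_span_singleton] at hx
    obtain ⟨t, ht⟩ := hx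
    exact ⟨t, by rw [← ht]; ring⟩
  obtain ⟨e, he⟩ := hε 1
  have hae : ε (a • e) = 0 := by
    rw [map_smul, he, Algebra.smul_def, mul_one, Ideal.Quotient.algebraMap_eq,
      Ideal.Quotient.mk_singleton_self]
  obtain ⟨y, hy⟩ := (hd' _).mp hae
  refine ⟨1 ⊗ₜ y, by rw [LinearMap.lTensor_tmul, hy, one_tmul_smul_eq_zero], ?_⟩
  rintro i ⟨w, hw⟩
  obtain ⟨w, rfl⟩ := TensorProduct.mk_surjective R P₂ _ Ideal.Quotient.mk_surjective w
  rw [TensorProduct.mk_apply, LinearMap.lTensor_tmul] at hw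
  obtain ⟨v, hv⟩ := exists_smul_eq_of_one_tmul_eq_zero (a := a) (x := i • y - d₂ w)
    (by rw [tmul_sub, tmul_smul, ← hw, sub_self])
  obtain ⟨r, hr⟩ := hmem (c := 1) (by rw [he, map_one])
  obtain ⟨t, ht⟩ := hmem (x := d₁ v) (c := 0) (by rw [hd'.apply_apply_eq_zero, map_zero])
  have hfin := congrArg (fun x ↦ f (d₁ x)) hv
  simp only [map_sub, map_smul, hd.apply_apply_eq_zero, hy, hr, ht, smul_eq_mul, map_zero] at hfin
  exact ⟨t - i * r, by linear_combination -hfin⟩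

theorem exists_isSemiregular_of_isQTorsion_tor1Mod {R : Type u} [CommRing R] (a : R)
    (h : IsQTorsion R (Tor1Mod R (R ⧸ Ideal.span {a}) (R ⧸ Ideal.span {a}))) :
    ∃ I : Ideal R, I.FG ∧ I.IsSemiregular ∧ ∀ i ∈ I, ∃ r, i * a = a * a * r := by
  obtain ⟨P₂, P₁, P₀, d₂, d₁, ε, _, hd, hd', hε, h'⟩ :=
    exists_exact_isQTorsion_tor1Mod_iff R (R ⧸ Ideal.span {a}) (R ⧸ Ideal.span {a})
  obtain ⟨z, hz, hz'⟩ := exists_cycle_quotient_span_singleton a hd hd' hε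
  obtain ⟨I, hI, hI', hIz⟩ := h'.mp h z hz
  exact ⟨I, hI, hI', fun i hi ↦ hz' i (hIz i hi)⟩

theorem isReduced_of_isSemiregular_mul {R : Type*} [CommRing R]
    (h : ∀ a : R, ∃ I : Ideal R, I.FG ∧ I.IsSemiregular ∧ ∀ i ∈ I, ∃ r, i * a = a * a * r) :
    IsReduced R := by
  refine (isReduced_iff_pow_one_lt 2 one_lt_two).mpr fun a ha ↦ ?_
  obtain ⟨I, -, hI, hIa⟩ := h a
  rw [← Ideal.mem_bot, ← hI.annihilator_eq_bot, Submodule.mem_annihilator]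
  intro i hi
  obtain ⟨r, hr⟩ := hIa i hi
  rw [smul_eq_mul, mul_comm, hr, ← sq, ha, zero_mul]

/-- The minimal primes of a reduced ring form a compact space if each `a` has a finite set of
annihilators which together with `a` generates a dense ideal. -/
theorem compactSpace_minimalPrimes {R : Type*} [CommRing R] [IsReduced R]
    (h : ∀ a : R, ∃ J : Ideal R, J.FG ∧ (∀ b ∈ J, a * b = 0) ∧
      Submodule.annihilator (Ideal.span {a} ⊔ J) = ⊥) :
    CompactSpace {p : PrimeSpectrum R // p.asIdeal ∈ minimalPrimes R} := by
  refine ⟨isCompact_iff_ultrafilter_le_nhds.mpr fun F _ ↦ ?_⟩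
  let G : Filter {p : PrimeSpectrum R // p.asIdeal ∈ minimalPrimes R} := F
  have : G.NeBot := F.neBot
  let p : Ideal R :=
    { carrier := {a : R | ∀ᶠ q in G, a ∈ q.1.asIdeal}
      zero_mem' := Filter.Eventually.of_forall fun q ↦ q.1.asIdeal.zero_mem
      add_mem' := fun {a b} ha hb ↦ by
        filter_upwards [ha, hb] with q using q.1.asIdeal.add_mem
      smul_mem' := fun c a ha ↦ by
        filter_upwards [ha] with q using q.1.asIdeal.mul_mem_left c }
  have hp : p.IsPrime := by
    refine ⟨fun htop ↦ ?_, fun {x y} hxy ↦ ?_⟩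
    · have : ∀ᶠ q in G, (1 : R) ∈ q.1.asIdeal := (Ideal.eq_top_iff_one p).mp htop
      obtain ⟨q, hq⟩ := this.exists
      exact q.1.2.one_notMem hq
    · exact Ultrafilter.eventually_or.mp (Filter.Eventually.mono hxy fun q ↦ q.1.2.mem_or_mem)
  have hmin : p ∈ minimalPrimes R := by
    obtain ⟨q, hq, hqp⟩ := Ideal.exists_minimalPrimes_le (bot_le : ⊥ ≤ p)
    suffices p ≤ q from (le_antisymm this hqp) ▸ hq
    intro a ha
    by_contra haq
    obtain ⟨J, hJ, haJ, hdense⟩ := h a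
    have hq' := hq.isPrime
    have hJp : J ≤ p := fun b hb ↦
      hqp ((hq'.mem_or_mem (haJ b hb ▸ q.zero_mem)).resolve_left haq)
    obtain ⟨t, rfl⟩ := hJ
    have hev : ∀ᶠ r in G, ∀ b ∈ t, b ∈ r.1.asIdeal :=
      (Filter.eventually_all_finset t).mpr fun b hb ↦ hJp (Ideal.subset_span hb)
    obtain ⟨r, hra, hrt⟩ := (Filter.Eventually.and ha hev).exists
    have hfg : (Ideal.span {a} ⊔ Ideal.span (t : Set R)).FG :=
      (Submodule.fg_span_singleton a).sup (Submodule.fg_span t.finite_toSet)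
    refine hfg.not_le_of_mem_minimalPrimes hdense r.2 (sup_le ?_ (Ideal.span_le.mpr hrt))
    exact (Ideal.span_singleton_le_iff_mem _).mpr hra
  refine ⟨⟨⟨p, hp⟩, hmin⟩, Set.mem_univ _, ?_⟩
  rw [nhds_subtype_eq_comap, ← Filter.map_le_iff_le_comap,
    PrimeSpectrum.isTopologicalBasis_basic_opens.nhds_hasBasis.ge_iff]
  rintro _ ⟨⟨a, rfl⟩, ha⟩
  exact Ultrafilter.eventually_not.mpr ha

theorem exists_annihilator_sup_eq_bot {R : Type*} [CommRing R] {a : R}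
    (h : ∃ I : Ideal R, I.FG ∧ I.IsSemiregular ∧ ∀ i ∈ I, ∃ r, i * a = a * a * r) :
    ∃ J : Ideal R, J.FG ∧ (∀ b ∈ J, a * b = 0) ∧
      Submodule.annihilator (Ideal.span {a} ⊔ J) = ⊥ := by
  obtain ⟨_, ⟨t, rfl⟩, hI, hIa⟩ := h
  choose! r hr using hIa
  let J := Ideal.span ((fun i ↦ i - a * r i) '' (t : Set R))
  refine ⟨J, Submodule.fg_span (t.finite_toSet.image _), fun b hb ↦ ?_, ?_⟩
  · have hle : J ≤ Submodule.annihilator (Ideal.span {a}) := by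
      refine Ideal.span_le.mpr ?_
      rintro _ ⟨i, hi, rfl⟩
      refine (Submodule.mem_annihilator_span_singleton _ _).mpr ?_
      rw [smul_eq_mul]
      linear_combination hr i (Ideal.subset_span hi)
    rw [mul_comm]
    exact (Submodule.mem_annihilator_span_singleton _ _).mp (hle hb)
  · rw [eq_bot_iff, ← hI.annihilator_eq_bot]
    refine Submodule.annihilator_mono (Ideal.span_le.mpr fun i hi ↦ ?_)
    have h1 : i - a * r i ∈ J := Ideal.subset_span ⟨i, hi, rfl⟩
    have h2 : a * r i ∈ Ideal.span {a} := Ideal.mul_mem_right _ _ (Ideal.mem_span_singleton_self a)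
    simpa using add_mem (Ideal.mem_sup_right h1) (Ideal.mem_sup_left h2)

/-- Every `R`-module is τ_q-flat if and only if `R` is reduced and the space of
minimal primes of `R` (with the subspace topology from `Spec R`) is compact. -/
theorem statement15 (R : Type u) [CommRing R] :
    (∀ (M : Type u) [AddCommGroup M] [Module R M], IsTauQFlat R M) ↔
      (IsReduced R ∧ CompactSpace {p : PrimeSpectrum R // p.asIdeal ∈ minimalPrimes R}) := by
  constructor
  · intro h
    have hI (a : R) := exists_isSemiregular_of_isQTorsion_tor1Mod a (h _ _)
    have := isReduced_of_isSemiregular_mul hI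
    exact ⟨this, compactSpace_minimalPrimes fun a ↦ exists_annihilator_sup_eq_bot (hI a)⟩
  · rintro ⟨_, _⟩ M _ _
    exact isTauQFlat_of_compactSpace_minimalPrimes M
end
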